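/- Let v₋, v₀, v₊ be reals, Δx > 0, 0 ≤ α₋, α₊ ≤ 1, and suppose σ satisfies the TVD bounds σ ≥ (2/Δx)·max(min(α₋(v₀−v₋), 0), min(α₊(v₊−v₀), 0)) and σ ≤ (2/Δx)·min(max(α₋(v₀−v₋), 0), max(α₊(v₊−v₀), 0)). Then for all x with |x| ≤ Δx/2, |σ·x| ≤ min(α₋·|v₀−v₋|, α₊·|v₊−v₀|). -/

import Mathlib

theorem stmt_7 (vm v₀ vp Δx αm αp σ : ℝ) (hΔx : 0 < Δx)
    (hαm : 0 ≤ αm) (hαm1 : αm ≤ 1) (hαp : 0 ≤ αp) (hαp1 : αp ≤ 1)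
    (hlo : σ ≥ (2 / Δx) * max (min (αm * (v₀ - vm)) 0) (min (αp * (vp - v₀)) 0))
    (hhi : σ ≤ (2 / Δx) * min (max (αm * (v₀ - vm)) 0) (max (αp * (vp - v₀)) 0)) :
    ∀ x : ℝ, |x| ≤ Δx / 2 →
      |σ * x| ≤ min (αm * |v₀ - vm|) (αp * |vp - v₀|) := by
  intro x hx
  have ha : αm * |v₀ - vm| = |αm * (v₀ - vm)| := by rw [abs_mul, abs_of_nonneg hαm]
  have hb : αp * |vp - v₀| = |αp * (vp - v₀)| := by rw [abs_mul, abs_of_nonneg hαp]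
  rw [ha, hb]
  generalize αm * (v₀ - vm) = a at *
  generalize αp * (vp - v₀) = b at *
  have hc : 0 < 2 / Δx := by positivity
  have h1 : min (max a 0) (max b 0) ≤ min |a| |b| :=
    min_le_min (max_le (le_abs_self a) (abs_nonneg a)) (max_le (le_abs_self b) (abs_nonneg b))
  have h2 : -min |a| |b| ≤ max (min a 0) (min b 0) := by
    rcases min_choice |a| |b| with h | h <;> rw [h]
    · exact le_max_of_le_left (le_min (neg_abs_le a) (by simp))
    · exact le_max_of_le_right (le_min (neg_abs_le b) (by simp))
  have hs : |σ| ≤ 2 / Δx * min |a| |b| := by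
    rw [abs_le]
    have h3 := mul_le_mul_of_nonneg_left h1 hc.le
    have h4 := mul_le_mul_of_nonneg_left h2 hc.le
    constructor <;> linarith
  rw [abs_mul]
  calc |σ| * |x| ≤ (2 / Δx * min |a| |b|) * (Δx / 2) :=
        mul_le_mul hs hx (abs_nonneg x) ((abs_nonneg σ).trans hs)
    _ = min |a| |b| := by field_simp
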